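/- arXiv:1909.08678 — 2 statements merged into one kernel-verified Lean document; each statement's English description precedes it below -/
import Mathlib

section
/- Let v₀, w₀ ∈ ℝ⁴ with ω₀ := v₀∧w₀ ≠ 0, let ω ∈ Λ²(ℝ⁴) be a simple nonzero bivector satisfying ω₀∧ω = 0 but such that ω is not a real scalar multiple of ω₀, and let ξ ∈ ℝ⁴ with ξ_x ≠ 0. The following are equivalent: (i) there exist c₁, c₂ ∈ ℝ such that (c₂ v₀ − c₁ w₀)∧ξ = ω; (ii) ω∧ξ = 0 and ω₀∧ξ ≠ 0; (iii) there exist ṽ, w̃₀ ∈ ℝ⁴∖{0} such that ω₀ = ṽ∧w̃₀ and ω = ṽ∧ξ. -/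
noncomputable section

/-- Vectors in ℝ⁴. -/
abbrev V4 : Type := Fin 4 → ℝ

/-- The exterior algebra of ℝ⁴. -/
abbrev Ext4 : Type := ExteriorAlgebra ℝ V4

/-- The canonical inclusion of ℝ⁴ into its exterior algebra. -/
def ι4 (v : V4) : Ext4 := ExteriorAlgebra.ι ℝ v

/-- The wedge product v∧w of two vectors, as a bivector in Λ²(ℝ⁴). -/
def wedge (v w : V4) : Ext4 := ι4 v * ι4 w

/-- ξ ∈ (ℝ³∖{0})×ℝ: the first three coordinates of ξ are not all zero. -/
def spatialNonzero (ξ : V4) : Prop := ¬(ξ 0 = 0 ∧ ξ 1 = 0 ∧ ξ 2 = 0)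

/-- A bivector ω is simple if ω = v∧w for some v, w ∈ ℝ⁴. -/
def IsSimple (ω : Ext4) : Prop := ∃ v w : V4, ω = wedge v w

/-- A vector annihilating a nonzero simple bivector `a ∧ b` lies in the span of `a` and `b`. -/
theorem exists_smul_add_smul_of_wedge_mul_eq_zero {a b c : V4} (hab : wedge a b ≠ 0)
    (h : wedge a b * ι4 c = 0) : ∃ s t : ℝ, s • a + t • b = c := by
  rw [← Submodule.mem_span_pair]
  by_contra hc
  obtain ⟨d, hdc, hd⟩ := Submodule.exists_le_ker_of_notMem hc
  have ha : d a = 0 := hd (Submodule.subset_span (by simp))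
  have hb : d b = 0 := hd (Submodule.subset_span (by simp))
  have key := congrArg (CliffordAlgebra.contractLeft (Q := (0 : QuadraticForm ℝ V4)) d) h
  simp only [wedge, ι4, ExteriorAlgebra.ι, mul_assoc, CliffordAlgebra.contractLeft_ι_mul,
    CliffordAlgebra.contractLeft_ι, ha, hb, map_zero, zero_smul, zero_sub, mul_neg,
    neg_neg] at key
  rw [← mul_assoc, ← Algebra.commutes, ← Algebra.smul_def] at key
  exact hab ((smul_eq_zero.mp key).resolve_left hdc)

/-- If `a ∧ b ∧ c ≠ 0` and `a ∧ b ∧ p ∧ c = 0`, then `p` lies in the span of `a`, `b`, `c`. -/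
theorem exists_smul_add_smul_add_smul_of_wedge_mul_wedge_eq_zero {a b c p : V4}
    (habc : wedge a b * ι4 c ≠ 0) (h : wedge a b * wedge p c = 0) :
    ∃ r s t : ℝ, r • a + s • b + t • c = p := by
  rw [← Submodule.mem_span_triple]
  by_contra hp
  obtain ⟨d, hdp, hd⟩ := Submodule.exists_le_ker_of_notMem hp
  have ha : d a = 0 := hd (Submodule.subset_span (by simp))
  have hb : d b = 0 := hd (Submodule.subset_span (by simp))
  have hc : d c = 0 := hd (Submodule.subset_span (by simp))
  have key := congrArg (CliffordAlgebra.contractLeft (Q := (0 : QuadraticForm ℝ V4)) d) h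
  simp only [wedge, ι4, ExteriorAlgebra.ι, mul_assoc, CliffordAlgebra.contractLeft_ι_mul,
    CliffordAlgebra.contractLeft_ι, ha, hb, hc, map_zero, zero_smul, zero_sub, mul_neg,
    neg_neg, mul_zero, sub_zero, mul_smul_comm] at key
  rw [← mul_assoc] at key
  exact habc ((smul_eq_zero.mp key).resolve_left hdp)

theorem ι4_mul_self (v : V4) : ι4 v * ι4 v = 0 := ExteriorAlgebra.ι_sq_zero v

theorem wedge_self (v : V4) : wedge v v = 0 := ι4_mul_self v

theorem wedge_swap (v w : V4) : wedge w v = -wedge v w :=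
  eq_neg_of_add_eq_zero_left (ExteriorAlgebra.ι_add_mul_swap w v)

theorem wedge_add_left (u v w : V4) : wedge (u + v) w = wedge u w + wedge v w := by
  simp [wedge, ι4, add_mul]

theorem wedge_smul_left (r : ℝ) (v w : V4) : wedge (r • v) w = r • wedge v w := by
  simp [wedge, ι4]

theorem wedge_add_right (u v w : V4) : wedge u (v + w) = wedge u v + wedge u w := by
  simp [wedge, ι4, mul_add]

theorem wedge_smul_right (r : ℝ) (v w : V4) : wedge v (r • w) = r • wedge v w := by
  simp [wedge, ι4]

/-- The wedge of two combinations of `v`, `w` is the determinant of coefficients times `v ∧ w`. -/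
theorem wedge_smul_add_smul (a b c d : ℝ) (v w : V4) :
    wedge (a • v + b • w) (c • v + d • w) = (a * d - b * c) • wedge v w := by
  simp only [wedge_add_left, wedge_add_right, wedge_smul_left, wedge_smul_right, wedge_self,
    wedge_swap v w]
  module

theorem wedge_mul_ι4_right (v w : V4) : wedge v w * ι4 w = 0 := by
  rw [wedge, mul_assoc, ι4_mul_self, mul_zero]

theorem wedge_mul_ι4_left (v w : V4) : wedge v w * ι4 v = 0 := by
  rw [← neg_eq_zero, ← neg_mul, ← wedge_swap, wedge_mul_ι4_right]

theorem wedge_zero_left (w : V4) : wedge 0 w = 0 := by simp [wedge, ι4]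

theorem wedge_zero_right (v : V4) : wedge v 0 = 0 := by simp [wedge, ι4]

/-- A nonzero combination of `v` and `w` is a left factor of `v ∧ w`. -/
theorem exists_wedge_eq_wedge_smul_add_smul {s t : ℝ} {v w : V4} (h : s • v + t • w ≠ 0) :
    ∃ u, wedge v w = wedge (s • v + t • w) u := by
  have hst : s * s + t * t ≠ 0 := by
    intro h0
    obtain ⟨rfl, rfl⟩ := mul_self_add_mul_self_eq_zero.mp h0
    simp at h
  refine ⟨(-t / (s * s + t * t)) • v + (s / (s * s + t * t)) • w, ?_⟩
  rw [wedge_smul_add_smul]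
  have : s * (s / (s * s + t * t)) - t * (-t / (s * s + t * t)) = 1 := by
    rw [← div_self hst]
    ring
  rw [this, one_smul]

/-- Let ω₀ = v₀∧w₀ ≠ 0, let ω be a simple nonzero bivector with ω₀∧ω = 0 which is
not a real scalar multiple of ω₀, and let ξ ∈ ℝ⁴ with ξ_x ≠ 0.  TFAE:
(i) (c₂v₀ − c₁w₀)∧ξ = ω for some c₁, c₂ ∈ ℝ; (ii) ω∧ξ = 0 and ω₀∧ξ ≠ 0;
(iii) ω₀ = ṽ∧w̃₀ and ω = ṽ∧ξ for some nonzero ṽ, w̃₀ ∈ ℝ⁴. -/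
theorem stmt6 (v₀ w₀ : V4) (h₀ : wedge v₀ w₀ ≠ 0) (ω : Ext4) (hs : IsSimple ω)
    (hω : ω ≠ 0) (hperp : wedge v₀ w₀ * ω = 0)
    (hnpar : ∀ k : ℝ, ω ≠ k • wedge v₀ w₀)
    (ξ : V4) (hξ : spatialNonzero ξ) :
    ((∃ c₁ c₂ : ℝ, wedge (c₂ • v₀ - c₁ • w₀) ξ = ω) ↔
        (ω * ι4 ξ = 0 ∧ wedge v₀ w₀ * ι4 ξ ≠ 0)) ∧
    ((∃ c₁ c₂ : ℝ, wedge (c₂ • v₀ - c₁ • w₀) ξ = ω) ↔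
        (∃ v' w' : V4, v' ≠ 0 ∧ w' ≠ 0 ∧ wedge v₀ w₀ = wedge v' w' ∧
          ω = wedge v' ξ)) := by
  have hξ0 : ξ ≠ 0 := by
    rintro rfl
    exact hξ ⟨rfl, rfl, rfl⟩
  refine ⟨⟨?_, ?_⟩, ?_, ?_⟩
  · rintro ⟨c₁, c₂, rfl⟩
    refine ⟨wedge_mul_ι4_right _ _, fun h => ?_⟩
    obtain ⟨s, t, rfl⟩ := exists_smul_add_smul_of_wedge_mul_eq_zero h₀ h
    apply hnpar (c₂ * t - -c₁ * s)
    rw [← wedge_smul_add_smul, neg_smul, ← sub_eq_add_neg]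
  · rintro ⟨h₁, h₂⟩
    obtain ⟨a, b, rfl⟩ := hs
    obtain ⟨s, t, rfl⟩ := exists_smul_add_smul_of_wedge_mul_eq_zero hω h₁
    obtain ⟨u, hu⟩ := exists_wedge_eq_wedge_smul_add_smul hξ0
    set ξ := s • a + t • b
    have hu' : wedge a b = wedge ((-1 : ℝ) • u) ξ := by
      rw [hu, wedge_smul_left, wedge_swap ξ u, neg_one_smul, neg_neg]
    rw [hu'] at hperp ⊢
    obtain ⟨x, y, z, hxyz⟩ := exists_smul_add_smul_add_smul_of_wedge_mul_wedge_eq_zero h₂ hperp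
    refine ⟨-y, x, ?_⟩
    rw [← hxyz, neg_smul, sub_neg_eq_add, wedge_add_left _ (z • ξ), wedge_smul_left z,
      wedge_self, smul_zero, add_zero]
  · rintro ⟨c₁, c₂, rfl⟩
    have hv : c₂ • v₀ - c₁ • w₀ ≠ 0 := by
      intro h
      rw [h, wedge_zero_left] at hω
      exact hω rfl
    obtain ⟨u, hu⟩ : ∃ u, wedge v₀ w₀ = wedge (c₂ • v₀ - c₁ • w₀) u := by
      rw [sub_eq_add_neg, ← neg_smul] at hv ⊢
      exact exists_wedge_eq_wedge_smul_add_smul hv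
    refine ⟨_, u, hv, ?_, hu, rfl⟩
    rintro rfl
    exact h₀ (hu.trans (wedge_zero_right _))
  · rintro ⟨v', w', -, -, h, rfl⟩
    obtain ⟨s, t, rfl⟩ := exists_smul_add_smul_of_wedge_mul_eq_zero (c := v') h₀
      (by rw [h, wedge_mul_ι4_left])
    exact ⟨-t, s, by rw [neg_smul, sub_neg_eq_add]⟩
end
end

section
/- Suppose V₀ = (u₀,S₀,B₀,E₀) ∈ ℳ, V = (u,S,B,E) ∈ Λ and λ ∈ (0,1) are such that the segment [V₀−(1−λ)V, V₀+λV] is a good Λ-segment. Write V₁ := V₀ + λV = (u₁,S₁,B₁,E₁) and V₂ := V₀ − (1−λ)V = (u₂,S₂,B₂,E₂), and assume E₁ = B₁ × u₁ and E₂ = B₂ × u₂. Then E₀ = B₀ × u₀. -/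
noncomputable section

/-- Vectors in ℝ³. -/
abbrev V3 : Type := Fin 3 → ℝ

/-- Euclidean inner product on ℝ³. -/
def dot3 (a b : V3) : ℝ := ∑ i, a i * b i

/-- Cross product on ℝ³. -/
def cross3 (a b : V3) : V3 :=
  ![a 1 * b 2 - a 2 * b 1, a 2 * b 0 - a 0 * b 2, a 0 * b 1 - a 1 * b 0]

/-- Euclidean norm on ℝ³. -/
def eNorm3 (a : V3) : ℝ := Real.sqrt (∑ i, (a i) ^ 2)

/-- 3×3 real matrices. -/
abbrev Mat3 : Type := Matrix (Fin 3) (Fin 3) ℝ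

/-- A state is a tuple V = (u, S, B, E). -/
abbrev MHDState : Type := V3 × Mat3 × V3 × V3

/-- The Euclidean norm on the state space. -/
def stateNorm (V : MHDState) : ℝ :=
  Real.sqrt ((∑ i, (V.1 i) ^ 2) + (∑ i, ∑ j, (V.2.1 i j) ^ 2) +
    (∑ i, (V.2.2.1 i) ^ 2) + (∑ i, (V.2.2.2 i) ^ 2))

/-- ξ = (ξ_x, ξ_t) annihilates the state V = (u, S, B, E) if ξ_x·u = 0, ξ_x·B = 0,
ξ_t u + S ξ_x = 0 and ξ_t B + ξ_x × E = 0. -/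
def Annihilates (ξx : V3) (ξt : ℝ) (V : MHDState) : Prop :=
  dot3 ξx V.1 = 0 ∧ dot3 ξx V.2.2.1 = 0 ∧
  ξt • V.1 + V.2.1.mulVec ξx = 0 ∧
  ξt • V.2.2.1 + cross3 ξx V.2.2.2 = 0

/-- The wave cone Λ: states with symmetric S admitting some ξ with ξ_x ≠ 0
annihilating them. -/
def WaveCone : Set MHDState :=
  {V | V.2.1.IsSymm ∧ ∃ ξx : V3, ∃ ξt : ℝ, ξx ≠ 0 ∧ Annihilates ξx ξt V}

/-- The set ℳ of states (with symmetric S) satisfying B·E = 0. -/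
def MSet : Set MHDState :=
  {V | V.2.1.IsSymm ∧ dot3 V.2.2.1 V.2.2.2 = 0}

/-- The segment [V₀ − (1−λ)V, V₀ + λV] is a good Λ-segment. -/
def GoodSegment (V₀ V : MHDState) (lam : ℝ) : Prop :=
  V₀ ∈ MSet ∧ V ∈ WaveCone ∧ 0 < lam ∧ lam < 1 ∧
  (∀ t : ℝ, -(1 - lam) ≤ t → t ≤ lam → V₀ + t • V ∈ MSet) ∧
  ∃ ξx : V3, ∃ ξt : ℝ, ξx ≠ 0 ∧ Annihilates ξx ξt V ∧
    ((V.2.2.1 = 0 ∧ V.2.2.2 = 0) ∨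
     (dot3 ξx V₀.2.2.1 ≠ 0 ∨ ξt • V₀.2.2.1 + cross3 ξx V₀.2.2.2 ≠ 0) ∨
     (∃ k : ℝ, k ≠ -(1 / lam) ∧ k ≠ 1 / (1 - lam) ∧
       V.2.2.1 = k • V₀.2.2.1 ∧ V.2.2.2 = k • V₀.2.2.2 ∧
       ¬(V.2.2.1 = 0 ∧ V.2.2.2 = 0)) ∨
     (V.1 = 0 ∧ V.2.1 = 0 ∧ V₀.2.2.1 = 0 ∧ V₀.2.2.2 = 0))

/-- The iterated lamination sets Y^{N,Λ}. -/
def lamHull (Y : Set MHDState) : ℕ → Set MHDState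
  | 0 => Y
  | N + 1 => lamHull Y N ∪
      {Z | ∃ lam : ℝ, ∃ V W : MHDState, 0 ≤ lam ∧ lam ≤ 1 ∧
        V ∈ lamHull Y N ∧ W ∈ lamHull Y N ∧ V - W ∈ WaveCone ∧
        Z = lam • V + (1 - lam) • W}

/-- The lamination convex hull Y^{lc,Λ}. -/
def lcHull (Y : Set MHDState) : Set MHDState := ⋃ N : ℕ, lamHull Y N

/-- The iterated good lamination sets Y^{k,Λ_g}. -/
def lamHullG (Y : Set MHDState) : ℕ → Set MHDState
  | 0 => Y
  | k + 1 => lamHullG Y k ∪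
      {V₀ | ∃ lam : ℝ, ∃ V : MHDState, GoodSegment V₀ V lam ∧
        V₀ + lam • V ∈ lamHullG Y k ∧ V₀ - (1 - lam) • V ∈ lamHullG Y k}

/-- The good lamination convex hull Y^{lc,Λ_g}. -/
def lcHullG (Y : Set MHDState) : Set MHDState := ⋃ k : ℕ, lamHullG Y k

/-- A set of states is relatively open in ℳ. -/
def RelOpen (U : Set MHDState) : Prop :=
  ∀ V ∈ U, ∃ δ : ℝ, 0 < δ ∧ ∀ W ∈ MSet, stateNorm (W - V) < δ → W ∈ U

/-- The tensor product a⊗b of two vectors in ℝ³. -/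
def outer (a b : V3) : Mat3 := Matrix.of fun i j => a i * b j

/-- The constitutive set K_{r,s}. -/
def Kset (r s : ℝ) : Set MHDState :=
  {V | ∃ q : ℝ, |q| ≤ r * s ∧
    V.2.1 = outer V.1 V.1 - outer V.2.2.1 V.2.2.1 + q • (1 : Mat3) ∧
    V.2.2.2 = cross3 V.2.2.1 V.1 ∧
    eNorm3 (V.1 + V.2.2.1) = r ∧ eNorm3 (V.1 - V.2.2.1) = s}

/-- 𝒰_{r,s}: the relative interior of K_{r,s}^{lc,Λ} in ℳ. -/
def Uset (r s : ℝ) : Set MHDState :=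
  {V | V ∈ MSet ∧ ∃ δ : ℝ, 0 < δ ∧
    ∀ W ∈ MSet, stateNorm (W - V) < δ → W ∈ lcHull (Kset r s)}

/-- The Frobenius norm on 3×3 matrices. -/
def frobNorm (M : Mat3) : ℝ := Real.sqrt (∑ i, ∑ j, (M i j) ^ 2)

/-- The relatively open sets 𝒱_{r',s',c}. -/
def Vset (r' s' c : ℝ) : Set MHDState :=
  {V | V.2.1.IsSymm ∧ dot3 V.2.2.1 V.2.2.2 = 0 ∧ ∃ q : ℝ,
    eNorm3 (V.1 + V.2.2.1) < r' + c ∧ eNorm3 (V.1 - V.2.2.1) < s' + c ∧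
    frobNorm (V.2.1 - (outer V.1 V.1 - outer V.2.2.1 V.2.2.1) - q • (1 : Mat3)) < c ∧
    |q| < r' * s' + c ∧ eNorm3 (V.2.2.2 - cross3 V.2.2.1 V.1) < c}

theorem cross3_eq_crossProduct (a b : V3) : cross3 a b = crossProduct a b := by
  rw [cross_apply]; rfl

theorem cross3_add_smul (b b' u u' : V3) (t : ℝ) :
    cross3 (b + t • b') (u + t • u') =
      cross3 b u + t • (cross3 b' u + cross3 b u') + t ^ 2 • cross3 b' u' := by
  simp only [cross3_eq_crossProduct, map_add, map_smul, LinearMap.add_apply,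
    LinearMap.smul_apply]
  module

/-- The triple product expansion. -/
theorem cross3_cross3 (a b c : V3) :
    cross3 a (cross3 b c) = dot3 a c • b - dot3 a b • c := by
  ext i
  fin_cases i <;> simp [cross3, dot3, Fin.sum_univ_three] <;> ring

/-- Along a segment, the failure of `E = B × u` at the intermediate point is a multiple of the
cross product of the directions. -/
theorem eq_cross3_add_of_endpoints {u₀ B₀ E₀ u B E : V3} {lam : ℝ}
    (h₁ : E₀ + lam • E = cross3 (B₀ + lam • B) (u₀ + lam • u))
    (h₂ : E₀ - (1 - lam) • E = cross3 (B₀ - (1 - lam) • B) (u₀ - (1 - lam) • u)) :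
    E₀ = cross3 B₀ u₀ + (lam * (1 - lam)) • cross3 B u ∧
      E = cross3 B u₀ + cross3 B₀ u + (2 * lam - 1) • cross3 B u := by
  rw [cross3_add_smul] at h₁
  rw [sub_eq_add_neg B₀, sub_eq_add_neg u₀, ← neg_smul, ← neg_smul, cross3_add_smul] at h₂
  constructor
  · linear_combination (norm := module) (1 - lam : ℝ) • h₁ + lam • h₂
  · linear_combination (norm := module) h₁ - h₂

/-- If `ξ` annihilates the direction of a segment whose endpoints satisfy `E = B × u` and the
direction has `B × u ≠ 0`, then `ξ` also annihilates the magnetic part of the base point. -/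
theorem base_annihilated_of_cross3_ne_zero {u₀ B₀ E₀ u B E ξx : V3} {ξt lam : ℝ}
    (h₁ : E₀ + lam • E = cross3 (B₀ + lam • B) (u₀ + lam • u))
    (h₂ : E₀ - (1 - lam) • E = cross3 (B₀ - (1 - lam) • B) (u₀ - (1 - lam) • u))
    (hu : dot3 ξx u = 0) (hB : dot3 ξx B = 0) (hE : ξt • B + cross3 ξx E = 0)
    (hne : cross3 B u ≠ 0) :
    dot3 ξx B₀ = 0 ∧ ξt • B₀ + cross3 ξx E₀ = 0 := by
  obtain ⟨hE₀, hE'⟩ := eq_cross3_add_of_endpoints h₁ h₂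
  have cross_add (a b c : V3) : cross3 a (b + c) = cross3 a b + cross3 a c := by
    simp only [cross3_eq_crossProduct, map_add]
  have cross_smul (t : ℝ) (a b : V3) : cross3 a (t • b) = t • cross3 a b := by
    simp only [cross3_eq_crossProduct, map_smul]
  have key : (ξt + dot3 ξx u₀) • B = dot3 ξx B₀ • u := by
    rw [hE'] at hE
    simp only [cross_add, cross_smul, cross3_cross3, hu, hB] at hE
    linear_combination (norm := module) hE
  have ha : (ξt + dot3 ξx u₀) • cross3 B u = 0 := by
    have := congrArg (fun v => crossProduct v u) key
    simpa [cross3_eq_crossProduct] using this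
  have hb : dot3 ξx B₀ • cross3 B u = 0 := by
    have := congrArg (fun v => crossProduct B v) key
    simpa [cross3_eq_crossProduct] using this.symm
  have ha' := (smul_eq_zero.mp ha).resolve_right hne
  have hb' := (smul_eq_zero.mp hb).resolve_right hne
  refine ⟨hb', ?_⟩
  rw [hE₀]
  simp only [cross_add, cross_smul, cross3_cross3, hu, hB, hb', eq_neg_of_add_eq_zero_left ha']
  module

/-- If [V₀−(1−λ)V, V₀+λV] is a good Λ-segment whose endpoints
V₁ = V₀+λV and V₂ = V₀−(1−λ)V satisfy E₁ = B₁ × u₁ and E₂ = B₂ × u₂,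
then E₀ = B₀ × u₀. -/
theorem stmt7 (V₀ V : MHDState) (lam : ℝ) (hgood : GoodSegment V₀ V lam)
    (h₁ : (V₀ + lam • V).2.2.2 = cross3 (V₀ + lam • V).2.2.1 (V₀ + lam • V).1)
    (h₂ : (V₀ - (1 - lam) • V).2.2.2 =
      cross3 (V₀ - (1 - lam) • V).2.2.1 (V₀ - (1 - lam) • V).1) :
    V₀.2.2.2 = cross3 V₀.2.2.1 V₀.1 := by
  obtain ⟨u₀, S₀, B₀, E₀⟩ := V₀
  obtain ⟨u, S, B, E⟩ := V
  obtain ⟨-, -, hl, hl', -, ξx, ξt, -, ⟨hu, hB, -, hE⟩, hcase⟩ := hgood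
  simp only [Prod.snd_add, Prod.snd_sub, Prod.fst_add, Prod.fst_sub, Prod.smul_snd,
    Prod.smul_fst] at *
  obtain ⟨hE₀, -⟩ := eq_cross3_add_of_endpoints h₁ h₂
  by_cases hw : cross3 B u = 0
  · simpa [hw] using hE₀
  rcases hcase with ⟨rfl, -⟩ | hb | ⟨k, hk, hk', rfl, rfl, -⟩ | ⟨rfl, -, -, -⟩
  · exact absurd (by simp [cross3_eq_crossProduct]) hw
  · obtain ⟨hb₁, hb₂⟩ := base_annihilated_of_cross3_ne_zero h₁ h₂ hu hB hE hw
    exact absurd hb₂ (hb.resolve_left (not_not.mpr hb₁))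
  · have hne₁ : 1 + lam * k ≠ 0 := by
      intro h
      apply hk
      field_simp
      linarith
    have hne₂ : 1 - (1 - lam) * k ≠ 0 := by
      intro h
      apply hk'
      have : 1 - lam ≠ 0 := by linarith
      field_simp
      linarith
    have e₁ : E₀ = cross3 B₀ (u₀ + lam • u) := by
      apply smul_right_injective V3 hne₁
      simp only [cross3_eq_crossProduct, map_add, map_smul, LinearMap.add_apply,
        LinearMap.smul_apply] at h₁ ⊢
      linear_combination (norm := module) h₁
    have e₂ : E₀ = cross3 B₀ (u₀ - (1 - lam) • u) := by
      apply smul_right_injective V3 hne₂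
      simp only [cross3_eq_crossProduct, map_sub, map_smul, LinearMap.sub_apply,
        LinearMap.smul_apply] at h₂ ⊢
      linear_combination (norm := module) h₂
    simp only [cross3_eq_crossProduct, map_add, map_sub, map_smul] at e₁ e₂ ⊢
    linear_combination (norm := module) (1 - lam : ℝ) • e₁ + lam • e₂
  · exact absurd (by simp [cross3_eq_crossProduct]) hw
end
end
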